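/- Suppose the coordinates Δ₁, …, Δ_p of the perturbation vector are i.i.d. with common law μ on ℝ satisfying μ({0}) = 0, where x and 1/x are μ-integrable with ∫ x dμ(x) = 0; suppose ε⁺, ε⁻ are integrable with mean 0, and Δ, ε⁺, ε⁻ are mutually independent. Then for the quadratic loss the simultaneous perturbation gradient estimate is unbiased: for every coordinate i ∈ {1, …, p}, E[ (L(θ₀ + cΔ) − L(θ₀ − cΔ) + ε⁺ − ε⁻) / (2c·Δᵢ) ] = gᵢ, the i-th component of the gradient of L at θ₀. -/

import Mathlib

open MeasureTheory Real Matrix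

/-- The central difference of a quadratic with symmetric Hessian is exactly its directional
derivative. -/
lemma quadratic_central_difference {n : Type*} [Fintype n] {Q : Matrix n n ℝ} (hQ : Q.IsSymm)
    (b x v : n → ℝ) :
    ((1 / 2) * ((x + v) ⬝ᵥ Q *ᵥ (x + v)) + b ⬝ᵥ (x + v))
      - ((1 / 2) * ((x - v) ⬝ᵥ Q *ᵥ (x - v)) + b ⬝ᵥ (x - v)) = 2 * ((Q *ᵥ x + b) ⬝ᵥ v) := by
  have h : x ⬝ᵥ Q *ᵥ v = v ⬝ᵥ Q *ᵥ x := by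
    rw [dotProduct_mulVec, ← mulVec_transpose, hQ.eq, dotProduct_comm]
  simp only [mulVec_add, mulVec_sub, dotProduct_add, add_dotProduct, dotProduct_sub,
    sub_dotProduct, h, dotProduct_comm (Q *ᵥ x) v]
  ring

section Ratio

variable {ι : Type*} [Fintype ι] {μ : Measure ℝ} [IsProbabilityMeasure μ]

lemma indepFun_eval_inv_eval_pi {i j : ι} (hij : j ≠ i) :
    ProbabilityTheory.IndepFun (fun x : ι → ℝ => x j) (fun x => (x i)⁻¹)
      (Measure.pi fun _ => μ) :=
  ((ProbabilityTheory.iIndepFun_pi (μ := fun _ : ι => μ) (X := fun _ x => x)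
    fun _ => aemeasurable_id).indepFun hij).comp measurable_id measurable_inv

lemma integrable_eval_mul_inv_eval_pi (hμ0 : μ {0} = 0)
    (hi : Integrable (fun x => x) μ) (hinv : Integrable (fun x => x⁻¹) μ) (i j : ι) :
    Integrable (fun x : ι → ℝ => x j * (x i)⁻¹) (Measure.pi fun _ => μ) := by
  by_cases hij : j = i
  · subst hij
    have h : Integrable (fun y : ℝ => y * y⁻¹) μ := by
      refine (integrable_const (1 : ℝ)).congr ?_
      filter_upwards [measure_eq_zero_iff_ae_notMem.1 hμ0] with y hy
      exact (mul_inv_cancel₀ hy).symm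
    exact (measurePreserving_eval (fun _ : ι => μ) j).integrable_comp_of_integrable h
  · exact (indepFun_eval_inv_eval_pi hij).integrable_mul
      ((measurePreserving_eval (fun _ : ι => μ) j).integrable_comp_of_integrable hi)
      ((measurePreserving_eval (fun _ : ι => μ) i).integrable_comp_of_integrable hinv)

lemma integral_eval_mul_inv_eval_pi [DecidableEq ι] (hμ0 : μ {0} = 0)
    (hmean : ∫ x, x ∂μ = 0) (i j : ι) :
    ∫ x : ι → ℝ, x j * (x i)⁻¹ ∂(Measure.pi fun _ => μ) = if j = i then 1 else 0 := by
  split_ifs with hij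
  · subst hij
    have h : ∀ᵐ y ∂μ, y * y⁻¹ = 1 := by
      filter_upwards [measure_eq_zero_iff_ae_notMem.1 hμ0] with y hy
      exact mul_inv_cancel₀ hy
    have hpi : ∀ᵐ x : ι → ℝ ∂(Measure.pi fun _ => μ), x j * (x j)⁻¹ = 1 :=
      (measurePreserving_eval (fun _ : ι => μ) j).quasiMeasurePreserving.ae h
    simp [integral_congr_ae hpi]
  · rw [(indepFun_eval_inv_eval_pi hij).integral_fun_mul_eq_mul_integral
      (measurable_pi_apply j).aestronglyMeasurable
      (measurable_pi_apply i).inv.aestronglyMeasurable,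
      integral_comp_eval (μ := fun _ : ι => μ) (f := fun y : ℝ => y) aestronglyMeasurable_id,
      hmean, zero_mul]

end Ratio

/-- Unbiasedness of the simultaneous perturbation gradient estimate for a quadratic loss
`L(θ) = (1/2)θᵀQθ + bᵀθ`: for every coordinate `i`,
`E[(L(θ₀ + cΔ) − L(θ₀ − cΔ) + ε⁺ − ε⁻)/(2cΔᵢ)] = gᵢ`, the i-th component of the
gradient `g = Qθ₀ + b`. -/
theorem stmt_11
    (p : ℕ) (hp : 1 ≤ p)
    (Q : Matrix (Fin p) (Fin p) ℝ) (hQ : Q.IsSymm) (b : Fin p → ℝ)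
    (θ₀ : Fin p → ℝ) (a c : ℝ) (ha : 0 < a) (hc : 0 < c)
    (L : (Fin p → ℝ) → ℝ)
    (hL : ∀ θ, L θ = (1 / 2) * (θ ⬝ᵥ Q.mulVec θ) + b ⬝ᵥ θ)
    (g : Fin p → ℝ) (hg : g = Q.mulVec θ₀ + b)
    (μ : Measure ℝ) [IsProbabilityMeasure μ]
    (hμ0 : μ {0} = 0)
    (hi1 : Integrable (fun x => x) μ) (hi3 : Integrable (fun x => x⁻¹) μ)
    (hmean : ∫ x, x ∂μ = 0)
    (νp νm : Measure ℝ) [IsProbabilityMeasure νp] [IsProbabilityMeasure νm]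
    (hνp1 : Integrable (fun x => x) νp) (hνm1 : Integrable (fun x => x) νm)
    (hνpmean : ∫ x, x ∂νp = 0) (hνmmean : ∫ x, x ∂νm = 0)
    (P : Measure ((Fin p → ℝ) × ℝ × ℝ))
    (hP : P = (Measure.pi fun _ : Fin p => μ).prod (νp.prod νm))
    (i : Fin p) :
    ∫ ω, (L (θ₀ + c • ω.1) - L (θ₀ - c • ω.1) + ω.2.1 - ω.2.2) / (2 * c * ω.1 i) ∂P
      = g i := by
  have hdecomp : ∀ ω : (Fin p → ℝ) × ℝ × ℝ,
      (L (θ₀ + c • ω.1) - L (θ₀ - c • ω.1) + ω.2.1 - ω.2.2) / (2 * c * ω.1 i)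
        = (∑ j, g j * (ω.1 j * (ω.1 i)⁻¹)) + (ω.1 i)⁻¹ * ((2 * c)⁻¹ * (ω.2.1 - ω.2.2)) := by
    intro ω
    have hsum : ∑ j, g j * (ω.1 j * (ω.1 i)⁻¹) = (g ⬝ᵥ ω.1) * (ω.1 i)⁻¹ := by
      simp only [dotProduct, Finset.sum_mul, mul_assoc]
    rw [hsum, hL, hL, quadratic_central_difference hQ, ← hg, dotProduct_smul, smul_eq_mul,
      div_eq_mul_inv, mul_inv]
    field_simp
    ring
  have hratio (j : Fin p) : Integrable (fun x : Fin p → ℝ => g j * (x j * (x i)⁻¹))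
      (Measure.pi fun _ => μ) :=
    (integrable_eval_mul_inv_eval_pi hμ0 hi1 hi3 i j).const_mul _
  have hsignal := integrable_finsetSum Finset.univ fun j _ => hratio j
  have hinv : Integrable (fun x : Fin p → ℝ => (x i)⁻¹) (Measure.pi fun _ => μ) :=
    (measurePreserving_eval (fun _ : Fin p => μ) i).integrable_comp_of_integrable hi3
  have hp1 : Integrable (fun e : ℝ × ℝ => e.1) (νp.prod νm) := hνp1.comp_fst νm
  have hm1 : Integrable (fun e : ℝ × ℝ => e.2) (νp.prod νm) := hνm1.comp_snd νp
  have hnoise : Integrable (fun e : ℝ × ℝ => (2 * c)⁻¹ * (e.1 - e.2)) (νp.prod νm) :=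
    (hp1.sub hm1).const_mul _
  have hnoise0 : ∫ e : ℝ × ℝ, (2 * c)⁻¹ * (e.1 - e.2) ∂(νp.prod νm) = 0 := by
    rw [integral_const_mul, integral_sub hp1 hm1, integral_fun_fst (fun x : ℝ => x),
      integral_fun_snd (fun x : ℝ => x), hνpmean, hνmmean]
    simp
  subst hP
  simp_rw [hdecomp]
  rw [integral_add (hsignal.comp_fst _) (hinv.mul_prod hnoise),
    integral_prod_mul (fun x : Fin p → ℝ => (x i)⁻¹)
      (fun e : ℝ × ℝ => (2 * c)⁻¹ * (e.1 - e.2)), hnoise0,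
    integral_fun_fst (fun x : Fin p → ℝ => ∑ j, g j * (x j * (x i)⁻¹)),
    integral_finsetSum _ fun j _ => hratio j]
  simp [integral_const_mul, integral_eval_mul_inv_eval_pi hμ0 hmean]
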